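/- If b does not belong to the moment body ℳ, then the log-partition function f is unbounded below: the range of f is not bounded below (equivalently, inf_{y ∈ ℝ^m} f(y) = −∞). -/

import Mathlib

open Matrix Filter
open scoped RealInnerProductSpace

/-- `A(y) = ∑ i, y i • A i`. -/
noncomputable def matA {n m : ℕ} (A : Fin m → Matrix (Fin n) (Fin n) ℝ)
    (y : EuclideanSpace ℝ (Fin m)) : Matrix (Fin n) (Fin n) ℝ :=
  ∑ i, y i • A i

/-- The log-partition function `f(y) = log tr exp A(y) - ⟨b, y⟩`. -/
noncomputable def logPart {n m : ℕ} (A : Fin m → Matrix (Fin n) (Fin n) ℝ)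
    (b : EuclideanSpace ℝ (Fin m)) (y : EuclideanSpace ℝ (Fin m)) : ℝ :=
  Real.log (Matrix.trace (NormedSpace.exp (matA A y))) - ⟪b, y⟫

/-- The linear map `𝒜(X) = (tr(A i * X))_i`. -/
noncomputable def Amap {n m : ℕ} (A : Fin m → Matrix (Fin n) (Fin n) ℝ)
    (X : Matrix (Fin n) (Fin n) ℝ) : EuclideanSpace ℝ (Fin m) :=
  WithLp.toLp 2 fun i => Matrix.trace (A i * X)

/-- The spectraplex: symmetric PSD matrices of unit trace. -/
def spectraplex (n : ℕ) : Set (Matrix (Fin n) (Fin n) ℝ) :=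
  {X | X.IsSymm ∧ X.PosSemidef ∧ X.trace = 1}

/-- The moment body `ℳ = 𝒜(spectraplex)`. -/
noncomputable def momentBody {n m : ℕ} (A : Fin m → Matrix (Fin n) (Fin n) ℝ) :
    Set (EuclideanSpace ℝ (Fin m)) :=
  Amap A '' spectraplex n

/-- The trace-normalized matrix exponential `X(y)`. -/
noncomputable def densityMat {n m : ℕ} (A : Fin m → Matrix (Fin n) (Fin n) ℝ)
    (y : EuclideanSpace ℝ (Fin m)) : Matrix (Fin n) (Fin n) ℝ :=
  (Matrix.trace (NormedSpace.exp (matA A y)))⁻¹ • NormedSpace.exp (matA A y)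

theorem convex_spectraplex (n : ℕ) : Convex ℝ (spectraplex n) := by
  rintro X ⟨hXs, hXp, hXt⟩ Y ⟨hYs, hYp, hYt⟩ a c ha hc hac
  refine ⟨(hXs.smul a).add (hYs.smul c), (hXp.smul ha).add (hYp.smul hc), ?_⟩
  simp [hXt, hYt, hac]

theorem isClosed_spectraplex (n : ℕ) : IsClosed (spectraplex n) := by
  have h : spectraplex n = {X | Xᵀ = X} ∩
      ((⋂ x : Fin n → ℝ, {X : Matrix (Fin n) (Fin n) ℝ | 0 ≤ x ⬝ᵥ (X *ᵥ x)}) ∩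
        {X | X.trace = 1}) := by
    ext X
    simp only [spectraplex, posSemidef_iff_dotProduct_mulVec, Matrix.IsHermitian, Matrix.IsSymm,
      conjTranspose_eq_transpose_of_trivial, star_trivial, Set.mem_inter_iff, Set.mem_iInter,
      Set.mem_ofPred_eq]
    tauto
  rw [h]
  refine (isClosed_eq (by fun_prop) (by fun_prop)).inter
    ((isClosed_iInter fun x => isClosed_le (by fun_prop) (by fun_prop)).inter
      (isClosed_eq (by fun_prop) (by fun_prop)))

theorem abs_apply_le_one_of_mem_spectraplex {n : ℕ} {X : Matrix (Fin n) (Fin n) ℝ}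
    (hX : X ∈ spectraplex n) (i j : Fin n) : |X i j| ≤ 1 := by
  obtain ⟨hs, hp, ht⟩ := hX
  have hdiag (k : Fin n) : X k k ≤ 1 := by
    rw [← ht]
    exact Finset.single_le_sum (f := fun k => X k k) (fun k _ => hp.diag_nonneg)
      (Finset.mem_univ k)
  have hsymm : X j i = X i j := hs.apply i j
  have hadd := hp.dotProduct_mulVec_nonneg (Pi.single i 1 + Pi.single j 1)
  have hsub := hp.dotProduct_mulVec_nonneg (Pi.single i 1 - Pi.single j 1)
  simp [mulVec_add, mulVec_sub, add_dotProduct, sub_dotProduct] at hadd hsub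
  rw [abs_le]
  constructor <;> linarith [hdiag i, hdiag j]

theorem isCompact_spectraplex (n : ℕ) : IsCompact (spectraplex n) := by
  have hbox : IsCompact (Set.univ.pi fun _ : Fin n => Set.univ.pi fun _ : Fin n =>
      Set.Icc (-1 : ℝ) 1) :=
    isCompact_univ_pi fun _ => isCompact_univ_pi fun _ => isCompact_Icc
  exact hbox.of_isClosed_subset (isClosed_spectraplex n) fun X hX i _ j _ =>
    abs_le.1 (abs_apply_le_one_of_mem_spectraplex hX i j)

theorem convex_momentBody {n m : ℕ} (A : Fin m → Matrix (Fin n) (Fin n) ℝ) :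
    Convex ℝ (momentBody A) := by
  rintro _ ⟨X, hX, rfl⟩ _ ⟨Y, hY, rfl⟩ a c ha hc hac
  refine ⟨a • X + c • Y, convex_spectraplex n hX hY ha hc hac, ?_⟩
  ext i
  simp [Amap, mul_add]

theorem isClosed_momentBody {n m : ℕ} (A : Fin m → Matrix (Fin n) (Fin n) ℝ) :
    IsClosed (momentBody A) := by
  refine ((isCompact_spectraplex n).image ?_).isClosed
  unfold Amap
  fun_prop

theorem inner_Amap {n m : ℕ} (A : Fin m → Matrix (Fin n) (Fin n) ℝ)
    (y : EuclideanSpace ℝ (Fin m)) (X : Matrix (Fin n) (Fin n) ℝ) :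
    ⟪y, Amap A X⟫ = (matA A y * X).trace := by
  simp [Amap, matA, PiLp.inner_apply, Finset.sum_mul, trace_sum, mul_comm]

theorem isHermitian_matA {n m : ℕ} {A : Fin m → Matrix (Fin n) (Fin n) ℝ}
    (hA : ∀ i, (A i)ᵀ = A i) (y : EuclideanSpace ℝ (Fin m)) : (matA A y).IsHermitian := by
  simp [Matrix.IsHermitian, matA, transpose_sum, hA]

theorem Matrix.IsHermitian.trace_exp {n : ℕ} {H : Matrix (Fin n) (Fin n) ℝ}
    (hH : H.IsHermitian) :
    (NormedSpace.exp H).trace = ∑ i, Real.exp (hH.eigenvalues i) := by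
  conv_lhs => rw [hH.spectral_theorem]
  rw [Unitary.conjStarAlgAut_apply]
  have h := Matrix.exp_units_conj (Unitary.toUnits hH.eigenvectorUnitary)
    (diagonal (RCLike.ofReal ∘ hH.eigenvalues : Fin n → ℝ))
  have h2 : (((Unitary.toUnits hH.eigenvectorUnitary)⁻¹ : (Matrix (Fin n) (Fin n) ℝ)ˣ) :
    Matrix (Fin n) (Fin n) ℝ) = star (hH.eigenvectorUnitary : Matrix (Fin n) (Fin n) ℝ) := rfl
  rw [h2, Unitary.val_toUnits_apply] at h
  rw [h, trace_mul_cycle, Unitary.coe_star_mul_self, one_mul, Matrix.exp_diagonal, trace_diagonal]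
  simp [Pi.coe_exp, Real.exp_eq_exp_ℝ]

/-- The rank-one projection onto an eigenvector lies in the spectraplex and recovers the
eigenvalue. -/
theorem Matrix.IsHermitian.exists_mem_spectraplex_trace_mul {n : ℕ}
    {H : Matrix (Fin n) (Fin n) ℝ} (hH : H.IsHermitian) (j : Fin n) :
    ∃ X ∈ spectraplex n, (H * X).trace = hH.eigenvalues j := by
  set v : Fin n → ℝ := ⇑(hH.eigenvectorBasis j) with hv
  have hvv : v ⬝ᵥ v = 1 := by
    have h := hH.eigenvectorBasis.orthonormal.1 j
    have h' := real_inner_self_eq_norm_sq (hH.eigenvectorBasis j)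
    rw [h, EuclideanSpace.inner_eq_star_dotProduct] at h'
    simpa using h'
  refine ⟨vecMulVec v v, ⟨?_, ?_, ?_⟩, ?_⟩
  · simp [Matrix.IsSymm, transpose_vecMulVec]
  · simpa using posSemidef_vecMulVec_self_star v
  · rw [trace_vecMulVec, hvv]
  · rw [mul_vecMulVec, hv, hH.mulVec_eigenvectorBasis j, trace_vecMulVec, smul_dotProduct,
      hvv, smul_eq_mul, mul_one]

theorem logPart_le {n m : ℕ} (hn : 1 ≤ n) {A : Fin m → Matrix (Fin n) (Fin n) ℝ}
    (hA : ∀ i, (A i)ᵀ = A i) (b y : EuclideanSpace ℝ (Fin m)) {u : ℝ}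
    (hu : ∀ z ∈ momentBody A, ⟪y, z⟫ ≤ u) :
    logPart A b y ≤ Real.log n + u - ⟪b, y⟫ := by
  have hH := isHermitian_matA hA y
  have heig (j : Fin n) : hH.eigenvalues j ≤ u := by
    obtain ⟨X, hX, hXj⟩ := hH.exists_mem_spectraplex_trace_mul j
    rw [← hXj, ← inner_Amap]
    exact hu _ ⟨X, hX, rfl⟩
  have hn0 : (n : ℝ) ≠ 0 := by positivity
  have hsum : ∑ j, Real.exp (hH.eigenvalues j) ≤ n * Real.exp u :=
    (Finset.sum_le_sum fun j _ => Real.exp_le_exp.2 (heig j)).trans_eq (by simp)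
  have hpos : 0 < ∑ j, Real.exp (hH.eigenvalues j) :=
    Finset.sum_pos (fun j _ => Real.exp_pos _) ⟨⟨0, hn⟩, Finset.mem_univ _⟩
  have hlog := Real.log_le_log hpos hsum
  rw [Real.log_mul hn0 (Real.exp_pos u).ne', Real.log_exp] at hlog
  rw [logPart, hH.trace_exp]
  linarith

/-- if b is infeasible then f is unbounded below. -/
theorem stmt19 (n m : ℕ) (hn : 1 ≤ n)
    (A : Fin m → Matrix (Fin n) (Fin n) ℝ) (hA : ∀ i, (A i)ᵀ = A i)
    (b : EuclideanSpace ℝ (Fin m)) (hb : b ∉ momentBody A) :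
    ¬ BddBelow (Set.range (logPart A b)) := by
  rintro ⟨c, hc⟩
  obtain ⟨g, u, hgM, hgb⟩ :=
    geometric_hahn_banach_closed_point (convex_momentBody A) (isClosed_momentBody A) hb
  set d := (InnerProductSpace.toDual ℝ (EuclideanSpace ℝ (Fin m))).symm g
  have hd (z : EuclideanSpace ℝ (Fin m)) : ⟪d, z⟫ = g z :=
    InnerProductSpace.toDual_symm_apply
  have hδ : 0 < g b - u := sub_pos.2 hgb
  obtain ⟨k, hk⟩ := exists_nat_gt ((Real.log n - c) / (g b - u))
  rw [div_lt_iff₀ hδ] at hk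
  have hle := logPart_le hn hA b ((k : ℝ) • d) (u := k * u) fun z hz => by
    rw [real_inner_smul_left, hd]
    exact mul_le_mul_of_nonneg_left (hgM z hz).le k.cast_nonneg
  rw [real_inner_smul_right, real_inner_comm, hd] at hle
  have hlow : c ≤ logPart A b ((k : ℝ) • d) := hc ⟨_, rfl⟩
  linarith
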